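/- arXiv:1210.8268 — 5 statements merged into one kernel-verified Lean document; each statement's English description precedes it below -/
import Mathlib

section
/- Let m ≥ 1, let H be a finite Borel measure on the unit simplex S_m satisfying ∫_{S_m} w_i dH(w) = 1 for every i ∈ {1,…,m}, and let {V_B : B ∈ C_m} be the associated complete set of exponent measures. For each nonempty L ⊆ {1,…,m} and each y ∈ ℝ^m with positive coordinates, define d_L(y) = ∑_{B ∈ C_m, B ⊇ M_m∖L} (−1)^{|B ∩ L| + 1} V_B(y_B). Then for every B ∈ C_m and every such y, V_B(y_B) = ∑_{L ∈ C_m, L ∩ B ≠ ∅} d_L(y). -/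
open MeasureTheory Finset

theorem aux_sum {m : ℕ} (C D : Finset (Fin m)) :
    ∑ L ∈ Finset.univ.filter (fun L : Finset (Fin m) => Lᶜ ⊆ C ∧ L ⊆ D),
      (-1 : ℝ) ^ ((C ∩ L).card) = if C = Dᶜ then 1 else 0 := by
  by_cases h : Cᶜ ⊆ D
  · have h1 : ∑ L ∈ Finset.univ.filter (fun L : Finset (Fin m) => Lᶜ ⊆ C ∧ L ⊆ D),
      (-1 : ℝ) ^ ((C ∩ L).card) = ∑ S ∈ (C ∩ D).powerset, (-1 : ℝ) ^ S.card := by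
      refine Finset.sum_bij' (fun L _ => C ∩ L) (fun S _ => Cᶜ ∪ S) ?_ ?_ ?_ ?_ ?_
      · intro L hL
        simp only [Finset.mem_filter, Finset.mem_univ, true_and, Finset.mem_powerset] at *
        exact Finset.inter_subset_inter_left hL.2
      · intro S hS
        simp only [Finset.mem_filter, Finset.mem_univ, true_and, Finset.mem_powerset,
          Finset.subset_iff, Finset.mem_union, Finset.mem_compl, Finset.mem_inter] at *
        grind
      · intro L hL
        simp only [Finset.mem_filter, Finset.mem_univ, true_and, 
          Finset.subset_iff, Finset.mem_compl] at hL
        ext x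
        simp only [Finset.mem_union, Finset.mem_compl, Finset.mem_inter]
        grind
      · intro S hS
        simp only [Finset.mem_powerset, Finset.subset_iff, Finset.mem_inter] at hS
        ext x
        simp only [Finset.mem_union, Finset.mem_compl, Finset.mem_inter]
        grind
      · intro L hL
        rfl
    rw [h1]
    have h2 := congrArg (Int.cast : ℤ → ℝ)
      (Finset.sum_powerset_neg_one_pow_card (x := C ∩ D))
    push_cast at h2
    rw [h2]
    have : C ∩ D = ∅ ↔ C = Dᶜ := by
      simp only [Finset.ext_iff, Finset.subset_iff, Finset.mem_compl, Finset.mem_inter,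
        Finset.notMem_empty] at *
      grind
    simp only [this]
  · rw [if_neg (by rintro rfl; simp at h)]
    apply Finset.sum_eq_zero
    intro L hL
    simp only [Finset.mem_filter, Finset.mem_univ, true_and, Finset.subset_iff,
      Finset.mem_compl] at *
    grind

/-- With `d_L(y) = ∑_{B ∈ C_m, B ⊇ M_m∖L} (−1)^{|B∩L|+1} V_B(y_B)`, every
exponent measure decomposes as `V_B(y_B) = ∑_{L ∈ C_m, L ∩ B ≠ ∅} d_L(y)`. -/
theorem exponent_measures_d_representation
    (m : ℕ) (hm : 1 ≤ m)
    (H : Measure (Fin m → ℝ)) [IsFiniteMeasure H]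
    (hsupp : ∀ᵐ w ∂H, (∀ i, 0 ≤ w i) ∧ ∑ i, w i = 1)
    (hmarg : ∀ i : Fin m, ∫ w, w i ∂H = 1)
    (V : Finset (Fin m) → (Fin m → ℝ) → ℝ)
    (hV : ∀ (B : Finset (Fin m)) (y : Fin m → ℝ),
        V B y = ∫ w, (⨆ j ∈ B, w j / y j) ∂H)
    (d : Finset (Fin m) → (Fin m → ℝ) → ℝ)
    (hd : ∀ (L : Finset (Fin m)) (y : Fin m → ℝ),
        d L y = ∑ B ∈ Finset.univ.filter
            (fun B : Finset (Fin m) => B.Nonempty ∧ Lᶜ ⊆ B),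
          (-1 : ℝ) ^ ((B ∩ L).card + 1) * V B y) :
    ∀ (B : Finset (Fin m)), B.Nonempty → ∀ (y : Fin m → ℝ), (∀ i, 0 < y i) →
      V B y = ∑ L ∈ Finset.univ.filter
          (fun L : Finset (Fin m) => (L ∩ B).Nonempty),
        d L y := by
  intro B hB y _
  simp only [hd, Finset.sum_filter]
  have key : ∀ C : Finset (Fin m), C.Nonempty →
      ∑ L : Finset (Fin m), (if (L ∩ B).Nonempty ∧ Lᶜ ⊆ C then
        (-1 : ℝ) ^ ((C ∩ L).card + 1) else 0) = if C = B then 1 else 0 := by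
    intro C hC
    have a1 := aux_sum C Finset.univ
    have a2 := aux_sum C Bᶜ
    rw [Finset.compl_univ, if_neg hC.ne_empty] at a1
    rw [compl_compl] at a2
    have a3 := congrArg₂ (fun a b : ℝ => a - b) a2 a1
    simp only [sub_zero] at a3
    rw [← a3]
    simp only [Finset.sum_filter]
    rw [← Finset.sum_sub_distrib]
    refine Finset.sum_congr rfl fun L _ => ?_
    have h3 : L ⊆ Bᶜ ↔ ¬ (L ∩ B).Nonempty := by
      rw [Finset.not_nonempty_iff_eq_empty, ← Finset.disjoint_iff_inter_eq_empty,
        Finset.subset_compl_iff_disjoint_right]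
    by_cases h1 : (L ∩ B).Nonempty <;> by_cases h2 : Lᶜ ⊆ C <;> simp [h1, h2, h3, pow_succ]
  calc V B y = ∑ C : Finset (Fin m), (if C.Nonempty then (if C = B then 1 else 0) * V C y else 0) := by
        rw [Finset.sum_eq_single B]
        · simp [hB]
        · intro C _ h
          simp [h]
        · simp
    _ = ∑ C : Finset (Fin m), ∑ L : Finset (Fin m), (if (L ∩ B).Nonempty then
          (if C.Nonempty ∧ Lᶜ ⊆ C then (-1 : ℝ) ^ ((C ∩ L).card + 1) * V C y else 0) else 0) := by
        refine Finset.sum_congr rfl fun C _ => ?_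
        by_cases hC : C.Nonempty
        · rw [if_pos hC, ← key C hC, Finset.sum_mul]
          refine Finset.sum_congr rfl fun L _ => ?_
          by_cases h1 : (L ∩ B).Nonempty <;> by_cases h2 : Lᶜ ⊆ C <;> simp [h1, h2, hC]
        · simp [hC]
    _ = _ := by
        rw [Finset.sum_comm]
        refine Finset.sum_congr rfl fun L _ => ?_
        by_cases h1 : (L ∩ B).Nonempty <;> simp [h1]
end

section
/- Let M be a finite set and let C denote the collection of nonempty subsets of M. Suppose f, g : C → ℝ satisfy f(B) = ∑_{L ∈ C, L ∩ B ≠ ∅} g(L) for every B ∈ C. Then g is uniquely determined by f via Möbius inversion: for every L ∈ C, g(L) = ∑_{B ∈ C, B ⊇ M∖L} (−1)^{|B ∩ L| + 1} f(B). -/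
open Finset

lemma aux_alt {α : Type*} [DecidableEq α] (x : Finset α) :
    ∑ S ∈ x.powerset, (-1 : ℝ) ^ S.card = if x = ∅ then 1 else 0 := by
  have := congrArg (fun z : ℤ => (z : ℝ)) (Finset.sum_powerset_neg_one_pow_card (x := x))
  push_cast at this
  exact this

lemma aux_coeff {α : Type*} [Fintype α] [DecidableEq α] (L K : Finset α) (hL : L.Nonempty) :
    ∑ S ∈ L.powerset, (-1 : ℝ) ^ (S.card + 1) * (if (K ∩ (Lᶜ ∪ S)).Nonempty then 1 else 0)
      = if K = L then 1 else 0 := by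
  have h1 : ∀ S ∈ L.powerset,
      (-1 : ℝ) ^ (S.card + 1) * (if (K ∩ (Lᶜ ∪ S)).Nonempty then 1 else 0)
      = -(-1 : ℝ) ^ S.card + (if K ⊆ L ∧ S ⊆ L \ K then (-1 : ℝ) ^ S.card else 0) := by
    intro S hS
    rw [mem_powerset] at hS
    have key : (K ∩ (Lᶜ ∪ S)).Nonempty ↔ ¬ (K ⊆ L ∧ S ⊆ L \ K) := by
      rw [← not_iff_not, not_not, not_nonempty_iff_eq_empty, ← disjoint_iff_inter_eq_empty,
        disjoint_union_right, disjoint_compl_right_iff, subset_sdiff]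
      exact ⟨fun h => ⟨h.1, hS, h.2.symm⟩, fun h => ⟨h.1, h.2.2.symm⟩⟩
    by_cases hc : K ⊆ L ∧ S ⊆ L \ K
    · rw [if_neg (by rw [key]; exact not_not.2 hc), if_pos hc]; ring
    · rw [if_pos (key.2 hc), if_neg hc]; ring
  rw [sum_congr rfl h1, sum_add_distrib, sum_neg_distrib, aux_alt, if_neg hL.ne_empty]
  by_cases hK : K ⊆ L
  · simp only [hK, true_and]
    rw [← sum_filter]
    have : L.powerset.filter (fun S => S ⊆ L \ K) = (L \ K).powerset := by
      ext S
      simp only [mem_filter, mem_powerset]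
      exact ⟨fun h => h.2, fun h => ⟨h.trans sdiff_subset, h⟩⟩
    rw [this, aux_alt, neg_zero, zero_add]
    congr 1
    rw [sdiff_eq_empty_iff_subset]
    exact propext ⟨fun h => hK.antisymm h, fun h => h ▸ subset_rfl⟩
  · have : K ≠ L := fun h => hK (h ▸ subset_rfl)
    simp [hK, this]

/-- Möbius inversion. If `f(B) = ∑_{L ∈ C, L ∩ B ≠ ∅} g(L)` for every nonempty
`B ⊆ M`, then `g(L) = ∑_{B ∈ C, B ⊇ M∖L} (−1)^{|B∩L|+1} f(B)` for every nonempty `L ⊆ M`. -/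
theorem moebius_inversion_nonempty_subsets
    {α : Type*} [Fintype α] [DecidableEq α] [Nonempty α]
    (f g : Finset α → ℝ)
    (h : ∀ B : Finset α, B.Nonempty →
        f B = ∑ L ∈ Finset.univ.filter
            (fun L : Finset α => (L ∩ B).Nonempty), g L) :
    ∀ L : Finset α, L.Nonempty →
      g L = ∑ B ∈ Finset.univ.filter
          (fun B : Finset α => B.Nonempty ∧ Lᶜ ⊆ B),
        (-1 : ℝ) ^ ((B ∩ L).card + 1) * f B := by
  intro L hL
  have e1 : ∑ B ∈ Finset.univ.filter (fun B : Finset α => B.Nonempty ∧ Lᶜ ⊆ B),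
        (-1 : ℝ) ^ ((B ∩ L).card + 1) * f B
      = ∑ B ∈ Finset.univ.filter (fun B : Finset α => Lᶜ ⊆ B),
        (-1 : ℝ) ^ ((B ∩ L).card + 1) *
          ∑ K : Finset α, g K * (if (K ∩ B).Nonempty then 1 else 0) := by
    have : ∀ B ∈ Finset.univ.filter (fun B : Finset α => B.Nonempty ∧ Lᶜ ⊆ B),
        (-1 : ℝ) ^ ((B ∩ L).card + 1) * f B = (-1 : ℝ) ^ ((B ∩ L).card + 1) *
          ∑ K : Finset α, g K * (if (K ∩ B).Nonempty then 1 else 0) := by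
      intro B hB
      rw [h B (mem_filter.1 hB).2.1, sum_filter]
      simp only [mul_ite, mul_one, mul_zero]
    rw [sum_congr rfl this]
    apply sum_subset
    · intro B hB
      simp only [mem_filter, mem_univ, true_and] at hB ⊢
      exact hB.2
    · intro B hB hB'
      simp only [mem_filter, mem_univ, true_and] at hB hB'
      have : B = ∅ := not_nonempty_iff_eq_empty.1 fun hn => hB' ⟨hn, hB⟩
      simp [this]
  have e2 : ∑ B ∈ Finset.univ.filter (fun B : Finset α => Lᶜ ⊆ B),
        (-1 : ℝ) ^ ((B ∩ L).card + 1) *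
          ∑ K : Finset α, g K * (if (K ∩ B).Nonempty then 1 else 0)
      = ∑ S ∈ L.powerset, (-1 : ℝ) ^ (S.card + 1) *
          ∑ K : Finset α, g K * (if (K ∩ (Lᶜ ∪ S)).Nonempty then 1 else 0) := by
    have hu : ∀ B : Finset α, Lᶜ ⊆ B → Lᶜ ∪ (B ∩ L) = B := by
      intro B hB
      ext x
      have := @hB x
      simp only [mem_union, mem_compl, mem_inter] at this ⊢
      tauto
    refine sum_bij' (fun B _ => B ∩ L) (fun S _ => Lᶜ ∪ S) ?_ ?_ ?_ ?_ ?_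
    · intro B _
      exact mem_powerset.2 inter_subset_right
    · intro S _
      simp
    · intro B hB
      exact hu B (mem_filter.1 hB).2
    · intro S hS
      have hS := mem_powerset.1 hS
      ext x
      have := @hS x
      simp only [mem_union, mem_compl, mem_inter]
      tauto
    · intro B hB
      simp only [hu B (mem_filter.1 hB).2]
  rw [e1, e2]
  simp only [mul_sum]
  rw [sum_comm]
  have : ∀ K : Finset α, ∑ S ∈ L.powerset, (-1 : ℝ) ^ (S.card + 1) *
      (g K * (if (K ∩ (Lᶜ ∪ S)).Nonempty then 1 else 0)) = g K * if K = L then 1 else 0 := by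
    intro K
    rw [← aux_coeff L K hL, mul_sum]
    exact sum_congr rfl fun S _ => by ring
  rw [sum_congr rfl fun K _ => this K]
  simp
end

section
/- Let M = {1,…,m} with m ≥ 1 and let x = (x_1,…,x_m) ∈ ℝ^m have nonnegative coordinates. Then for every nonempty L ⊆ M, the alternating sum ∑_{B ⊆ M, B nonempty, B ⊇ M∖L} (−1)^{|B ∩ L| + 1} max_{j ∈ B} x_j is nonnegative. -/
open Finset

lemma aux_le {m : ℕ} (x : Fin m → ℝ) (hx : ∀ i, 0 ≤ x i) (B : Finset (Fin m)) (c : ℝ) :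
    (⨆ j ∈ B, x j) ≤ c ↔ 0 ≤ c ∧ ∀ j ∈ B, x j ≤ c := by
  constructor
  · intro h
    refine ⟨le_trans (Real.iSup_nonneg fun j => Real.iSup_nonneg fun _ => hx j) h, ?_⟩
    intro j hj
    refine le_trans ?_ h
    have h1 : (⨆ _ : j ∈ B, x j) = x j := by simp [hj]
    rw [← h1]
    exact le_ciSup (f := fun j => ⨆ _ : j ∈ B, x j) (Set.finite_range _).bddAbove j
  · rintro ⟨hc, h⟩
    exact Real.iSup_le (fun j => Real.iSup_le (fun hj => h j hj) hc) hc

lemma aux_sum_s3 {m : ℕ} (x : Fin m → ℝ) (h : Finset (Fin m) → ℝ) (h0 : h ∅ = 0)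
    (hi : ∀ i C, h (insert i C) = max (x i) (h C))
    (L : Finset (Fin m)) (hL : L.Nonempty) :
    ∃ t : ℝ, ∀ a : ℝ, 0 ≤ a →
      ∑ C ∈ L.powerset, (-1 : ℝ) ^ (C.card + 1) * max a (h C) = max a t - a := by
  have key : ∀ (i : Fin m) (L : Finset (Fin m)), i ∉ L → ∀ a : ℝ,
      ∑ C ∈ (insert i L).powerset, (-1 : ℝ) ^ (C.card + 1) * max a (h C)
      = ∑ C ∈ L.powerset, (-1 : ℝ) ^ (C.card + 1) * max a (h C)
        - ∑ C ∈ L.powerset, (-1 : ℝ) ^ (C.card + 1) * max (max a (x i)) (h C) := by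
    intro i L hiL a
    rw [Finset.sum_powerset_insert hiL, sub_eq_add_neg, ← Finset.sum_neg_distrib]
    congr 1
    refine Finset.sum_congr rfl fun C hC => ?_
    have : i ∉ C := fun hh => hiL (Finset.mem_powerset.1 hC hh)
    rw [Finset.card_insert_of_notMem this, hi, max_assoc]
    ring
  induction hL using Finset.Nonempty.cons_induction with
  | singleton i =>
    refine ⟨x i, fun a ha => ?_⟩
    have := key i ∅ (by simp) a
    rw [insert_empty_eq] at this
    rw [this]
    simp only [powerset_empty, sum_singleton, card_empty, h0, max_eq_left ha,
      max_eq_left (le_trans ha (le_max_left a (x i)))]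
    ring
  | cons i L hiL hne ih =>
    obtain ⟨t, ht⟩ := ih
    refine ⟨min t (x i), fun a ha => ?_⟩
    rw [Finset.cons_eq_insert, key i L hiL, ht a ha, ht _ (le_trans ha (le_max_left a (x i)))]
    grind

/-- For nonnegative `x ∈ ℝ^m` and nonempty `L ⊆ M = {1,…,m}`,
`∑_{B ⊆ M, B nonempty, B ⊇ M∖L} (−1)^{|B∩L|+1} max_{j ∈ B} x_j ≥ 0`. -/
theorem alternating_sum_of_maxima_nonneg
    (m : ℕ) (hm : 1 ≤ m) (x : Fin m → ℝ) (hx : ∀ i, 0 ≤ x i)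
    (L : Finset (Fin m)) (hL : L.Nonempty) :
    0 ≤ ∑ B ∈ Finset.univ.filter
          (fun B : Finset (Fin m) => B.Nonempty ∧ Lᶜ ⊆ B),
        (-1 : ℝ) ^ ((B ∩ L).card + 1) * (⨆ j ∈ B, x j) := by
  have hle := aux_le x hx
  generalize hg : (fun B : Finset (Fin m) => ⨆ j ∈ B, x j) = g
  have hg' : ∀ B : Finset (Fin m), (⨆ j ∈ B, x j) = g B := fun B => congrFun hg B
  simp only [hg'] at hle ⊢
  have hnn : ∀ B, 0 ≤ g B := fun B => ((hle B _).1 le_rfl).1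
  have h0 : g ∅ = 0 := le_antisymm ((hle _ _).2 (by simp)) (hnn _)
  have hi : ∀ i C, g (insert i C) = max (x i) (g C) := by
    intro i C
    refine eq_of_forall_ge_iff fun c => ?_
    rw [max_le_iff, hle, hle]
    simp only [Finset.forall_mem_insert]
    tauto
  have hu : ∀ A C, g (A ∪ C) = max (g A) (g C) := by
    intro A C
    refine eq_of_forall_ge_iff fun c => ?_
    rw [max_le_iff, hle, hle, hle]
    simp only [Finset.forall_mem_union]
    tauto
  obtain ⟨t, ht⟩ := aux_sum_s3 x g h0 hi L hL
  have e1 : ∑ B ∈ Finset.univ.filter (fun B : Finset (Fin m) => B.Nonempty ∧ Lᶜ ⊆ B),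
        (-1 : ℝ) ^ ((B ∩ L).card + 1) * g B
      = ∑ B ∈ Finset.univ.filter (fun B : Finset (Fin m) => Lᶜ ⊆ B),
        (-1 : ℝ) ^ ((B ∩ L).card + 1) * g B := by
    refine Finset.sum_subset (fun B => by simp) fun B hB hB' => ?_
    have : B = ∅ := by
      by_contra hne
      simp only [mem_filter, mem_univ, true_and] at hB hB'
      exact hB' ⟨Finset.nonempty_iff_ne_empty.2 hne, hB⟩
    rw [this, h0, mul_zero]
  have e2 : ∑ B ∈ Finset.univ.filter (fun B : Finset (Fin m) => Lᶜ ⊆ B),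
        (-1 : ℝ) ^ ((B ∩ L).card + 1) * g B
      = ∑ C ∈ L.powerset, (-1 : ℝ) ^ (C.card + 1) * max (g Lᶜ) (g C) := by
    have hrec : ∀ B, Lᶜ ⊆ B → Lᶜ ∪ B ∩ L = B := by
      intro B hB
      ext j
      have := @hB j
      simp only [mem_compl, mem_union, mem_inter] at *
      tauto
    refine Finset.sum_nbij' (fun B => B ∩ L) (fun C => Lᶜ ∪ C) ?_ ?_ ?_ ?_ ?_
    · intro B _
      simp
    · intro C _
      simp
    · intro B hB
      exact hrec B (by simpa using hB)
    · intro C hC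
      ext j
      have : j ∈ C → j ∈ L := fun h => Finset.mem_powerset.1 hC h
      simp only [mem_compl, mem_union, mem_inter]
      tauto
    · intro B hB
      rw [← hu, hrec B (by simpa using hB)]
  rw [e1, e2, ht _ (hnn _)]
  exact sub_nonneg.2 (le_max_left _ _)
end

section
/- Let m ≥ 1 and let H be a finite Borel measure on the unit simplex S_m satisfying ∫_{S_m} w_i dH(w) = 1 for every i ∈ {1,…,m}. Define the extremal coefficients θ_B = ∫_{S_m} max_{i ∈ B} w_i dH(w) for each nonempty B ⊆ {1,…,m}. Then for every nonempty L ⊆ {1,…,m}, ∑_{B ∈ C_m, B ⊇ M_m∖L} (−1)^{|B ∩ L| + 1} θ_B ≥ 0. -/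
open MeasureTheory Finset

open scoped NNReal in
lemma alt_aux {ι : Type*} [DecidableEq ι] (v : ι → ℝ≥0) (L : Finset ι) (hL : L.Nonempty) :
    ∃ t : ℝ≥0, ∀ c : ℝ≥0,
      ∑ T ∈ L.powerset, (-1 : ℝ) ^ (T.card + 1) * ((c ⊔ T.sup v : ℝ≥0) : ℝ)
        = max ((t : ℝ) - c) 0 := by
  induction hL using Finset.Nonempty.cons_induction with
  | singleton a =>
    refine ⟨v a, fun c => ?_⟩
    have h : ({a} : Finset ι) = insert a ∅ := rfl
    rw [h, Finset.sum_powerset_insert (by simp)]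
    simp
    rcases le_total (c : ℝ) (v a) with h | h
    · rw [max_eq_right h, max_eq_left (by linarith)]; ring
    · rw [max_eq_left h, max_eq_right (by linarith)]; ring
  | cons a s ha hs ih =>
    obtain ⟨t, ht⟩ := ih
    refine ⟨t ⊓ v a, fun c => ?_⟩
    rw [Finset.cons_eq_insert, Finset.sum_powerset_insert ha, ht c]
    have h2 : ∑ T ∈ s.powerset, (-1 : ℝ) ^ ((insert a T).card + 1) *
        ((c ⊔ (insert a T).sup v : ℝ≥0) : ℝ) = - max ((t : ℝ) - ((c ⊔ v a : ℝ≥0) : ℝ)) 0 := by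
      rw [← ht (c ⊔ v a), ← Finset.sum_neg_distrib]
      refine Finset.sum_congr rfl fun T hT => ?_
      have haT : a ∉ T := fun h => ha (Finset.mem_powerset.1 hT h)
      rw [Finset.card_insert_of_notMem haT, Finset.sup_insert, ← sup_assoc]
      ring
    rw [h2]
    push_cast
    simp only [max_def, min_def]
    split_ifs <;> linarith

lemma iSup_aux {ι : Type*} [Fintype ι] (w : ι → ℝ) (hw : ∀ i, 0 ≤ w i) (B : Finset ι) :
    (⨆ i ∈ B, w i) = ((B.sup fun i => (w i).toNNReal : NNReal) : ℝ) := by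
  have hle : ∀ i ∈ B, w i ≤ ((B.sup fun i => (w i).toNNReal : NNReal) : ℝ) := fun i hi => by
    have := Finset.le_sup (f := fun i => (w i).toNNReal) hi
    have h2 : (((w i).toNNReal : NNReal) : ℝ) ≤ _ := NNReal.coe_le_coe.2 this
    rwa [Real.coe_toNNReal _ (hw i)] at h2
  apply le_antisymm
  · refine Real.iSup_le (fun i => Real.iSup_le (fun hi => hle i hi) (NNReal.coe_nonneg _))
      (NNReal.coe_nonneg _)
  · have h0 : 0 ≤ ⨆ i ∈ B, w i := Real.iSup_nonneg fun i => Real.iSup_nonneg fun _ => hw i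
    rw [← Real.le_toNNReal_iff_coe_le h0]
    refine Finset.sup_le fun i hi => Real.toNNReal_le_toNNReal ?_
    have h1 : w i = ⨆ _ : i ∈ B, w i := by simp [hi]
    rw [h1]
    exact le_ciSup (f := fun i => ⨆ _ : i ∈ B, w i) (Set.finite_range _).bddAbove i

/-- The extremal coefficients `θ_B = ∫_{S_m} max_{i∈B} w_i dH(w)` satisfy
`∑_{B ∈ C_m, B ⊇ M_m∖L} (−1)^{|B∩L|+1} θ_B ≥ 0` for every nonempty `L ⊆ {1,…,m}`. -/
theorem extremal_coefficients_alternating_sum_nonneg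
    (m : ℕ) (hm : 1 ≤ m)
    (H : Measure (Fin m → ℝ)) [IsFiniteMeasure H]
    (hsupp : ∀ᵐ w ∂H, (∀ i, 0 ≤ w i) ∧ ∑ i, w i = 1)
    (hmarg : ∀ i : Fin m, ∫ w, w i ∂H = 1)
    (θ : Finset (Fin m) → ℝ)
    (hθ : ∀ B : Finset (Fin m), θ B = ∫ w, (⨆ i ∈ B, w i) ∂H)
    (L : Finset (Fin m)) (hL : L.Nonempty) :
    0 ≤ ∑ B ∈ Finset.univ.filter
          (fun B : Finset (Fin m) => B.Nonempty ∧ Lᶜ ⊆ B),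
        (-1 : ℝ) ^ ((B ∩ L).card + 1) * θ B := by
  classical
  set g : Finset (Fin m) → (Fin m → ℝ) → ℝ :=
    fun B w => ((B.sup fun i => (w i).toNNReal : NNReal) : ℝ) with hg
  have hθ' : ∀ B, θ B = ∫ w, g B w ∂H := fun B => by
    rw [hθ]
    refine integral_congr_ae ?_
    filter_upwards [hsupp] with w hw
    exact iSup_aux w hw.1 B
  have hgint : ∀ B, Integrable (g B) H := fun B => by
    refine Integrable.of_bound (C := 1) ?_ ?_
    · have : Continuous (g B) := by
        refine NNReal.continuous_coe.comp ?_
        exact Continuous.finset_sup_apply fun i _ =>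
          continuous_real_toNNReal.comp (continuous_apply i)
      exact this.aestronglyMeasurable
    · filter_upwards [hsupp] with w hw
      rw [Real.norm_of_nonneg (NNReal.coe_nonneg _)]
      have : (B.sup fun i => (w i).toNNReal) ≤ 1 := Finset.sup_le fun i _ => by
        rw [Real.toNNReal_le_one, ← hw.2]
        exact Finset.single_le_sum (f := w) (fun j _ => hw.1 j) (Finset.mem_univ i)
      exact_mod_cast this
  have hre : ∑ B ∈ Finset.univ.filter
          (fun B : Finset (Fin m) => B.Nonempty ∧ Lᶜ ⊆ B),
        (-1 : ℝ) ^ ((B ∩ L).card + 1) * θ B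
      = ∑ T ∈ L.powerset, (-1 : ℝ) ^ (T.card + 1) * θ (Lᶜ ∪ T) := by
    have h1 : ∑ B ∈ Finset.univ.filter
          (fun B : Finset (Fin m) => B.Nonempty ∧ Lᶜ ⊆ B),
        (-1 : ℝ) ^ ((B ∩ L).card + 1) * θ B = ∑ B ∈ Finset.univ.filter
          (fun B : Finset (Fin m) => Lᶜ ⊆ B), (-1 : ℝ) ^ ((B ∩ L).card + 1) * θ B := by
      refine Finset.sum_subset (fun B hB => ?_) (fun B hB hB' => ?_)
      · simp only [Finset.mem_filter] at hB ⊢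
        exact ⟨hB.1, hB.2.2⟩
      · have : B = ∅ := by
          by_contra hne
          apply hB'
          simp only [Finset.mem_filter] at hB ⊢
          exact ⟨hB.1, Finset.nonempty_iff_ne_empty.2 hne, hB.2⟩
        rw [hθ' B, this]
        simp [hg]
    rw [h1]
    refine Finset.sum_bij' (fun B _ => B ∩ L) (fun T _ => Lᶜ ∪ T) ?_ ?_ ?_ ?_ ?_
    · intro B _
      simp
    · intro T _
      simp
    · intro B hB
      have hB := (Finset.mem_filter.1 hB).2
      ext x
      have := @hB x
      simp at this ⊢
      tauto
    · intro T hT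
      have hT := Finset.mem_powerset.1 hT
      ext x
      have := @hT x
      simp
      tauto
    · intro B hB
      have hB := (Finset.mem_filter.1 hB).2
      have : Lᶜ ∪ B ∩ L = B := by
        ext x
        have := @hB x
        simp at this ⊢
        tauto
      simp only [this]
  rw [hre]
  simp only [hθ', ← integral_const_mul]
  rw [← integral_finsetSum _ (fun T _ => (hgint _).const_mul _)]
  refine integral_nonneg fun w => ?_
  obtain ⟨t, ht⟩ := alt_aux (fun i => (w i).toNNReal) L hL
  have := ht (Lᶜ.sup fun i => (w i).toNNReal)
  simp only [hg, Finset.sup_union, Pi.zero_apply]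
  rw [this]
  exact le_max_right _ _
end

section
/- Let H be a finite Borel measure on the unit simplex S_3 ⊂ ℝ^3 satisfying ∫_{S_3} w_i dH(w) = 1 for i = 1, 2, 3, and let θ_B = ∫_{S_3} max_{i ∈ B} w_i dH(w) for nonempty B ⊆ {1,2,3}. Writing θ_{12}, θ_{13}, θ_{23}, θ_{123} for θ_{{1,2}}, θ_{{1,3}}, θ_{{2,3}}, θ_{{1,2,3}}, one has max{θ_{12}, θ_{13}, θ_{23}, θ_{12} + θ_{13} + θ_{23} − 3} ≤ θ_{123} ≤ min{θ_{12} + θ_{13} − 1, θ_{12} + θ_{23} − 1, θ_{13} + θ_{23} − 1}. -/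
open MeasureTheory Finset

lemma iSup_fin_three_real (f : Fin 3 → ℝ) : (⨆ i, f i) = max (f 0) (max (f 1) (f 2)) := by
  apply le_antisymm
  · apply ciSup_le
    intro i
    fin_cases i <;> simp
  · have h : ∀ i, f i ≤ ⨆ i, f i := fun i => le_ciSup (Set.finite_range f).bddAbove i
    exact max_le (h 0) (max_le (h 1) (h 2))

lemma max_aux (a b c : ℝ) (ha : 0 ≤ a) (hb : 0 ≤ b) (hc : 0 ≤ c) :
    max a b + max a c + max b c - (a + b + c) ≤ max a (max b c) := by
  have h1 := le_max_left a (max b c)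
  have h2 := (le_max_left b c).trans (le_max_right a (max b c))
  have h3 := (le_max_right b c).trans (le_max_right a (max b c))
  generalize max a (max b c) = m at *
  rcases max_cases a b with ⟨h, _⟩ | ⟨h, _⟩ <;> rcases max_cases a c with ⟨hac, _⟩ | ⟨hac, _⟩ <;>
    rcases max_cases b c with ⟨hbc, _⟩ | ⟨hbc, _⟩ <;> rw [h, hac, hbc] <;> linarith

lemma iSup_mem_real (B : Finset (Fin 3)) (w : Fin 3 → ℝ) (i : Fin 3) :
    (⨆ _ : i ∈ B, w i) = if i ∈ B then w i else 0 := by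
  by_cases h : i ∈ B
  · simp [h]
  · simp [h]

lemma biSup_eq (B : Finset (Fin 3)) (w : Fin 3 → ℝ) :
    (⨆ i ∈ B, w i) = max (if 0 ∈ B then w 0 else 0)
      (max (if 1 ∈ B then w 1 else 0) (if 2 ∈ B then w 2 else 0)) := by
  rw [iSup_fin_three_real]
  simp only [iSup_mem_real]

/-- Schlather–Tawn bounds in dimension 3:
`max{θ₁₂, θ₁₃, θ₂₃, θ₁₂+θ₁₃+θ₂₃−3} ≤ θ₁₂₃ ≤ min{θ₁₂+θ₁₃−1, θ₁₂+θ₂₃−1, θ₁₃+θ₂₃−1}`. -/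
theorem extremal_coefficient_bounds_dim_three
    (H : Measure (Fin 3 → ℝ)) [IsFiniteMeasure H]
    (hsupp : ∀ᵐ w ∂H, (∀ i, 0 ≤ w i) ∧ ∑ i, w i = 1)
    (hmarg : ∀ i : Fin 3, ∫ w, w i ∂H = 1)
    (θ : Finset (Fin 3) → ℝ)
    (hθ : ∀ B : Finset (Fin 3), θ B = ∫ w, (⨆ i ∈ B, w i) ∂H) :
    max (max (θ {0, 1}) (θ {0, 2}))
        (max (θ {1, 2}) (θ {0, 1} + θ {0, 2} + θ {1, 2} - 3)) ≤ θ {0, 1, 2} ∧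
    θ {0, 1, 2} ≤ min (θ {0, 1} + θ {0, 2} - 1)
        (min (θ {0, 1} + θ {1, 2} - 1) (θ {0, 2} + θ {1, 2} - 1)) := by
  have hi : ∀ i : Fin 3, Integrable (fun w : Fin 3 → ℝ => w i) H := by
    intro i
    by_contra h
    have := hmarg i
    rw [integral_undef h] at this
    norm_num at this
  have hadd : ∀ {f g : (Fin 3 → ℝ) → ℝ}, Integrable f H → Integrable g H →
      Integrable (fun w => f w + g w) H := fun hf hg => hf.add hg
  have hsub : ∀ {f g : (Fin 3 → ℝ) → ℝ}, Integrable f H → Integrable g H →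
      Integrable (fun w => f w - g w) H := fun hf hg => hf.sub hg
  have hite : ∀ (B : Finset (Fin 3)) (i : Fin 3),
      Integrable (fun w : Fin 3 → ℝ => if i ∈ B then w i else 0) H := by
    intro B i
    by_cases h : i ∈ B
    · simpa [h] using hi i
    · simp [h]
  have hI : ∀ B : Finset (Fin 3), Integrable (fun w : Fin 3 → ℝ => ⨆ i ∈ B, w i) H := by
    intro B
    simp only [biSup_eq]
    exact (hite B 0).sup ((hite B 1).sup (hite B 2))
  have mono : ∀ B C : Finset (Fin 3), B ⊆ C → θ B ≤ θ C := by
    intro B C hBC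
    rw [hθ, hθ]
    apply integral_mono_ae (hI B) (hI C)
    filter_upwards [hsupp] with w hw
    simp only [biSup_eq]
    have key : ∀ i, (if i ∈ B then w i else 0) ≤ (if i ∈ C then w i else 0) := by
      intro i
      have := hw.1 i
      by_cases h : i ∈ B
      · simp [h, hBC h]
      · simp only [h, if_false]
        split_ifs <;> simp [this]
    exact max_le_max (key 0) (max_le_max (key 1) (key 2))
  have upper : ∀ (B C D : Finset (Fin 3)) (j : Fin 3), B ∪ C = D → j ∈ B → j ∈ C →
      θ D ≤ θ B + θ C - 1 := by
    intro B C D j hD hB hC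
    rw [hθ, hθ, hθ, ← hmarg j, ← integral_add (hI B) (hI C),
      ← integral_sub (hadd (hI B) (hI C)) (hi j)]
    apply integral_mono_ae (hI D) (hsub (hadd (hI B) (hI C)) (hi j))
    filter_upwards [hsupp] with w hw
    have ub : ∀ (E : Finset (Fin 3)) (i : Fin 3), i ∈ E → w i ≤ ⨆ i ∈ E, w i := by
      intro E i hE
      rw [biSup_eq]
      fin_cases i <;> simp_all
    have h0 : ∀ (E : Finset (Fin 3)) (i : Fin 3), i ∈ E → 0 ≤ ⨆ i ∈ E, w i :=
      fun E i hE => (hw.1 i).trans (ub E i hE)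
    have hb := ub B j hB
    have hc := ub C j hC
    have hj := hw.1 j
    have key : ∀ i, (if i ∈ D then w i else 0) ≤ (⨆ i ∈ B, w i) + (⨆ i ∈ C, w i) - w j := by
      intro i
      split_ifs with h
      · rw [← hD, Finset.mem_union] at h
        rcases h with h | h
        · linarith [ub B i h]
        · linarith [ub C i h]
      · linarith
    change (⨆ i ∈ D, w i) ≤ (⨆ i ∈ B, w i) + (⨆ i ∈ C, w i) - w j
    rw [biSup_eq D]
    exact max_le (key 0) (max_le (key 1) (key 2))
  have lower : θ {0, 1} + θ {0, 2} + θ {1, 2} - 3 ≤ θ {0, 1, 2} := by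
    have h3 : (3 : ℝ) = ∫ w, (w 0 + w 1 + w 2) ∂H := by
      rw [integral_add (hadd (hi 0) (hi 1)) (hi 2), integral_add (hi 0) (hi 1),
        hmarg, hmarg, hmarg]
      norm_num
    have hs := hadd (hadd (hI {0, 1}) (hI {0, 2})) (hI {1, 2})
    have ht := hadd (hadd (hi 0) (hi 1)) (hi 2)
    rw [hθ {0, 1}, hθ {0, 2}, hθ {1, 2}, hθ {0, 1, 2}, h3,
      ← integral_add (hI {0, 1}) (hI {0, 2}),
      ← integral_add (hadd (hI {0, 1}) (hI {0, 2})) (hI {1, 2}), ← integral_sub hs ht]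
    apply integral_mono_ae (hsub hs ht) (hI {0, 1, 2})
    filter_upwards [hsupp] with w hw
    have h0 := hw.1 0
    have h1 := hw.1 1
    have h2 := hw.1 2
    change (⨆ i ∈ ({0, 1} : Finset (Fin 3)), w i) + (⨆ i ∈ ({0, 2} : Finset (Fin 3)), w i)
      + (⨆ i ∈ ({1, 2} : Finset (Fin 3)), w i) - (w 0 + w 1 + w 2)
      ≤ ⨆ i ∈ ({0, 1, 2} : Finset (Fin 3)), w i
    have e01 : (⨆ i ∈ ({0, 1} : Finset (Fin 3)), w i) = max (w 0) (w 1) := by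
      rw [biSup_eq]; simp [h1]
    have e02 : (⨆ i ∈ ({0, 2} : Finset (Fin 3)), w i) = max (w 0) (w 2) := by
      rw [biSup_eq]; simp [h2]
    have e12 : (⨆ i ∈ ({1, 2} : Finset (Fin 3)), w i) = max (w 1) (w 2) := by
      rw [biSup_eq]; simp [h1]
    have e012 : (⨆ i ∈ ({0, 1, 2} : Finset (Fin 3)), w i) = max (w 0) (max (w 1) (w 2)) := by
      rw [biSup_eq]; simp
    rw [e01, e02, e12, e012]
    exact max_aux _ _ _ h0 h1 h2
  refine ⟨max_le (max_le ?_ ?_) (max_le ?_ lower), le_min ?_ (le_min ?_ ?_)⟩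
  · exact mono _ _ (by decide)
  · exact mono _ _ (by decide)
  · exact mono _ _ (by decide)
  · exact upper _ _ _ 0 (by decide) (by decide) (by decide)
  · exact upper _ _ _ 1 (by decide) (by decide) (by decide)
  · exact upper _ _ _ 2 (by decide) (by decide) (by decide)
end
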